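/- arXiv:2210.13515 — 3 statements merged into one kernel-verified Lean document; each statement's English description precedes it below -/
import Mathlib

section
/- Let p be an odd prime. There exists l₀ : ℕ such that for every l ≥ l₀, every n ≥ 1, and every f : 𝔽_p^n → ℝ with 0 ≤ f ≤ 1, we have T_{Φ^{(l)}}(f) + T_{Φ^{(l)}}(1 − f) ≥ 2^{−(l+8)}. (In other words, the system Φ^{(l)} obtained from Φ by adding l free variables is common for all sufficiently large l; the system Φ is Alon.) -/
open Finset

/-- `G p n` is the vector space `𝔽_p^n`. -/
abbrev G (p n : ℕ) : Type := Fin n → ZMod p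

/-- The set of solutions in `(𝔽_p^n)^9` to the system `Φ`:
`x₁ - x₂ + x₃ - x₄ = 0` and `x₅ - x₆ + x₇ - x₈ + x₉ = 0`. -/
def phiSols (p n : ℕ) [NeZero p] : Finset (Fin 9 → G p n) :=
  Finset.univ.filter fun x =>
    x 0 - x 1 + x 2 - x 3 = 0 ∧ x 4 - x 5 + x 6 - x 7 + x 8 = 0

/-- `T_{Φ^{(l)}}(f)`: the average of `f(x₁)⋯f(x₉)·f(y₁)⋯f(y_l)` over all tuples
`(x, y) ∈ G^{9+l}` where `x` solves `Φ` and `y₁, …, y_l` are free. -/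
noncomputable def TphiL (p n l : ℕ) [NeZero p] (f : G p n → ℝ) : ℝ :=
  (∑ x ∈ phiSols p n, ∑ y : Fin l → G p n, (∏ i, f (x i)) * ∏ k, f (y k)) /
    ((phiSols p n).card * ((p : ℝ) ^ n) ^ l)

open scoped ComplexConjugate

/-- Normalised Fourier coefficient. -/
noncomputable def fhat {K : Type} [AddCommGroup K] [Fintype K] (f : K → ℝ) (ψ : AddChar K ℂ) : ℂ :=
  (∑ x, (f x : ℂ) * ψ x) / (Fintype.card K : ℂ)

lemma double_ne_zero {K : Type} [AddCommGroup K] [Fintype K] (hodd : Odd (Fintype.card K))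
    (ψ : AddChar K ℂ) (h : ψ ≠ 0) : ψ ^ 2 ≠ (0 : AddChar K ℂ) := by
  intro h2
  apply h
  ext x
  obtain ⟨k, hk⟩ := hodd
  have hx : x = (k + 1) • x + (k + 1) • x := by
    have : (Fintype.card K) • x = 0 := card_nsmul_eq_zero
    rw [hk] at this
    calc x = (2 * k + 1) • x + x := by rw [this, zero_add]
      _ = _ := by rw [← succ_nsmul, ← add_nsmul]; congr 1; omega
  have := DFunLike.congr_fun h2 ((k + 1) • x)
  rw [AddChar.pow_apply, sq, ← AddChar.map_add_eq_mul, ← hx] at this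
  exact this

lemma key_poly (w : ℂ) (hw : ‖w‖ = 1) :
    18 * |w.re| ≤ 12 + 7 * (w ^ 2).re - (w ^ 4).re := by
  have h1 : w.re ^ 2 + w.im ^ 2 = 1 := by
    have := Complex.sq_norm w
    rw [hw, Complex.normSq_apply] at this
    linarith
  have e2 : (w ^ 2).re = 2 * w.re ^ 2 - 1 := by
    have : (w ^ 2).re = w.re ^ 2 - w.im ^ 2 := by simp [sq]
    linarith
  have e4 : (w ^ 4).re = 8 * w.re ^ 4 - 8 * w.re ^ 2 + 1 := by
    have h4 : (w ^ 4).re = (w.re ^ 2 - w.im ^ 2) ^ 2 - 4 * w.re ^ 2 * w.im ^ 2 := by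
      have : w ^ 4 = (w * w) * (w * w) := by ring
      rw [this]; simp only [Complex.mul_re, Complex.mul_im]; ring
    have : w.im ^ 2 = 1 - w.re ^ 2 := by linarith
    rw [h4, this]; ring
  rw [e2, e4]
  have ha : |w.re| ≤ 1 := hw ▸ Complex.abs_re_le_norm w
  have h0 := abs_nonneg w.re
  have s2 : w.re ^ 2 = |w.re| ^ 2 := (sq_abs _).symm
  have s4 : w.re ^ 4 = |w.re| ^ 4 := by
    rw [show (4 : ℕ) = 2 * 2 by rfl, pow_mul, pow_mul, sq_abs]
  rw [s2, s4]
  generalize |w.re| = u at *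
  have : 0 ≤ (1 - u) * (2 * u - 1) ^ 2 * (u + 2) := by
    have : 0 ≤ 1 - u := by linarith
    positivity
  nlinarith

lemma fhat_bound {K : Type} [AddCommGroup K] [Fintype K] (hodd : Odd (Fintype.card K))
    (f : K → ℝ) (hf : ∀ x, 0 ≤ f x ∧ f x ≤ 1) (ψ : AddChar K ℂ) (h : ψ ≠ 0) :
    ‖fhat f ψ‖ ≤ 1 / 3 := by
  have hN : (0 : ℝ) < Fintype.card K := by exact_mod_cast Fintype.card_pos
  have h2 := double_ne_zero hodd ψ h
  have h4 : ψ ^ 4 ≠ 0 := by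
    have := double_ne_zero hodd _ h2
    rwa [← pow_mul] at this
  have z1 := AddChar.sum_eq_zero_iff_ne_zero.2 h
  have z2 := AddChar.sum_eq_zero_iff_ne_zero.2 h2
  have z4 := AddChar.sum_eq_zero_iff_ne_zero.2 h4
  simp only [AddChar.pow_apply] at z2 z4
  set a : ℂ := ∑ x, (f x : ℂ) * ψ x with ha
  have hfa : ‖fhat f ψ‖ = ‖a‖ / Fintype.card K := by
    rw [fhat, norm_div, ← ha]; simp
  rw [hfa, div_le_iff₀ hN]
  by_cases ha0 : a = 0
  · rw [ha0, norm_zero]; positivity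
  have hna : ‖a‖ ≠ 0 := norm_ne_zero_iff.2 ha0
  obtain ⟨θ, hθ, hθa⟩ : ∃ θ : ℂ, ‖θ‖ = 1 ∧ θ * a = ‖a‖ := by
    refine ⟨conj a / ‖a‖, ?_, ?_⟩
    · simp [hna]
    · have : (‖a‖ : ℂ) ≠ 0 := by exact_mod_cast hna
      rw [div_mul_eq_mul_div, Complex.conj_mul', sq, mul_div_assoc, div_self this, mul_one]
  have y1 : ∑ x, (θ * ψ x).re = 0 := by
    rw [← Complex.re_sum, ← mul_sum, z1]; simp
  have y2 : ∑ x, ((θ * ψ x) ^ 2).re = 0 := by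
    simp only [mul_pow]
    rw [← Complex.re_sum, ← mul_sum, z2]; simp
  have y4 : ∑ x, ((θ * ψ x) ^ 4).re = 0 := by
    simp only [mul_pow]
    rw [← Complex.re_sum, ← mul_sum, z4]; simp
  have ya : ‖a‖ = ∑ x, f x * (θ * ψ x).re := by
    have : (θ * a).re = ‖a‖ := by rw [hθa]; simp
    rw [← this, ha, mul_sum, Complex.re_sum]
    refine sum_congr rfl fun x _ => ?_
    rw [mul_left_comm, Complex.re_ofReal_mul]
  have key : ∀ x ∈ (univ : Finset K), f x * (θ * ψ x).re ≤
      (1 / 2) * (θ * ψ x).re + (1 / 36) * (12 + 7 * ((θ * ψ x) ^ 2).re - ((θ * ψ x) ^ 4).re) := by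
    intro x _
    have hk := key_poly (θ * ψ x) (by rw [norm_mul, hθ, AddChar.norm_apply, one_mul])
    have h3 : (f x - 1 / 2) * (θ * ψ x).re ≤ 1 / 2 * |(θ * ψ x).re| := by
      refine (le_abs_self _).trans ?_
      rw [abs_mul]
      refine mul_le_mul_of_nonneg_right ?_ (abs_nonneg _)
      rw [abs_le]; constructor <;> linarith [(hf x).1, (hf x).2]
    linarith
  have := sum_le_sum key
  rw [← ya, sum_add_distrib, ← mul_sum, ← mul_sum, sum_sub_distrib, sum_add_distrib, ← mul_sum,
    y1, y2, y4] at this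
  simp only [sum_const, card_univ, nsmul_eq_mul] at this
  linarith

lemma conj_sum_char {K : Type} [AddCommGroup K] [Fintype K] (f : K → ℝ) (ψ : AddChar K ℂ) :
    ∑ x, (f x : ℂ) * ψ (-x) = conj (∑ x, (f x : ℂ) * ψ x) := by
  rw [map_sum]
  refine sum_congr rfl fun x _ => ?_
  rw [map_mul, Complex.conj_ofReal, AddChar.map_neg_eq_conj]

lemma parseval {K : Type} [AddCommGroup K] [Fintype K] (f : K → ℝ) :
    ∑ ψ : AddChar K ℂ, ‖fhat f ψ‖ ^ 2 = (∑ x, f x ^ 2) / Fintype.card K := by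
  classical
  have hN : (Fintype.card K : ℂ) ≠ 0 := by exact_mod_cast Fintype.card_ne_zero
  have h : ∀ ψ : AddChar K ℂ, ((‖fhat f ψ‖ ^ 2 : ℝ) : ℂ) =
      (∑ x, ∑ y, (f x : ℂ) * f y * ψ (x - y)) / (Fintype.card K : ℂ) ^ 2 := by
    intro ψ
    push_cast
    rw [← Complex.mul_conj', fhat, map_div₀, ← conj_sum_char, div_mul_div_comm, sum_mul_sum]
    simp only [map_natCast, ← sq]
    congr 1
    refine sum_congr rfl fun x _ => sum_congr rfl fun y _ => ?_
    rw [sub_eq_add_neg, AddChar.map_add_eq_mul]; ring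
  have : ((∑ ψ : AddChar K ℂ, ‖fhat f ψ‖ ^ 2 : ℝ) : ℂ) =
      (((∑ x, f x ^ 2) / Fintype.card K : ℝ) : ℂ) := by
    rw [Complex.ofReal_sum]
    simp only [h]
    rw [← sum_div, sum_comm]
    have : ∀ x : K, ∑ ψ : AddChar K ℂ, ∑ y, (f x : ℂ) * f y * ψ (x - y) =
        Fintype.card K * (f x : ℂ) ^ 2 := by
      intro x
      rw [sum_comm]
      simp only [← mul_sum, AddChar.sum_apply_eq_ite, sub_eq_zero]
      simp
      ring
    simp only [this]
    rw [← mul_sum]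
    push_cast
    field_simp
  exact_mod_cast this

lemma fhat_zero {K : Type} [AddCommGroup K] [Fintype K] (f : K → ℝ) :
    fhat f 0 = (((∑ x, f x) / Fintype.card K : ℝ) : ℂ) := by
  simp [fhat]

lemma fhat_compl {K : Type} [AddCommGroup K] [Fintype K] (f : K → ℝ) (ψ : AddChar K ℂ)
    (h : ψ ≠ 0) : fhat (fun x => 1 - f x) ψ = - fhat f ψ := by
  have z1 := AddChar.sum_eq_zero_iff_ne_zero.2 h
  simp only [fhat, Complex.ofReal_sub, Complex.ofReal_one, sub_mul, one_mul, sum_sub_distrib, z1]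
  ring

lemma phi_count (p n : ℕ) [NeZero p] (f : G p n → ℝ) :
    (∑ x ∈ phiSols p n, ∏ i, f (x i)) = (Fintype.card (G p n) : ℝ) ^ 7 *
      ((∑ ψ : AddChar (G p n) ℂ, ‖fhat f ψ‖ ^ 4) *
        (∑ ψ : AddChar (G p n) ℂ, ‖fhat f ψ‖ ^ 4 * (fhat f ψ).re)) := by
  classical
  set N : ℕ := Fintype.card (G p n) with hNdef
  have hN : (N : ℂ) ≠ 0 := by exact_mod_cast Fintype.card_ne_zero
  let c : AddChar (G p n) ℂ → ℂ := fun ψ => ∑ x, (f x : ℂ) * ψ x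
  have hc : ∀ ψ, c ψ = N * fhat f ψ := by
    intro ψ
    simp only [c, fhat]
    rw [mul_div_cancel₀ _ hN]
  have h4 : ∀ z : ℂ, z * conj z * z * conj z = ((‖z‖ ^ 4 : ℝ) : ℂ) := by
    intro z
    rw [mul_assoc, Complex.mul_conj']
    push_cast; ring
  have step : ∀ ψ φ : AddChar (G p n) ℂ,
      ∑ x : Fin 9 → G p n, (∏ i, (f (x i) : ℂ)) * ψ (x 0 - x 1 + x 2 - x 3) *
        φ (x 4 - x 5 + x 6 - x 7 + x 8) =
      (c ψ * conj (c ψ) * c ψ * conj (c ψ)) * (c φ * conj (c φ) * c φ * conj (c φ) * c φ) := by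
    intro ψ φ
    let F : Fin 9 → G p n → ℂ := ![fun x => f x * ψ x, fun x => f x * ψ (-x),
      fun x => f x * ψ x, fun x => f x * ψ (-x), fun x => f x * φ x, fun x => f x * φ (-x),
      fun x => f x * φ x, fun x => f x * φ (-x), fun x => f x * φ x]
    have := prod_univ_sum (fun _ : Fin 9 => (univ : Finset (G p n))) F
    rw [Fintype.piFinset_univ] at this
    have e1 : ∏ i, ∑ j, F i j = (c ψ * conj (c ψ) * c ψ * conj (c ψ)) *
        (c φ * conj (c φ) * c φ * conj (c φ) * c φ) := by
      simp only [c, ← conj_sum_char]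
      rw [Fin.prod_univ_castSucc, Fin.prod_univ_eight]
      simp only [F]
      simp only [mul_assoc]
      rfl
    rw [← e1, this]
    refine sum_congr rfl fun x _ => ?_
    rw [Fin.prod_univ_castSucc, Fin.prod_univ_eight, Fin.prod_univ_castSucc, Fin.prod_univ_eight]
    simp only [sub_eq_add_neg, AddChar.map_add_eq_mul]
    change _ = (f (x 0) * ψ (x 0)) * (f (x 1) * ψ (-x 1)) * (f (x 2) * ψ (x 2)) *
      (f (x 3) * ψ (-x 3)) * (f (x 4) * φ (x 4)) * (f (x 5) * φ (-x 5)) * (f (x 6) * φ (x 6)) *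
      (f (x 7) * φ (-x 7)) * (f (x 8) * φ (x 8))
    change ((f (x 0) : ℂ) * f (x 1) * f (x 2) * f (x 3) * f (x 4) * f (x 5) * f (x 6) * f (x 7) *
      f (x 8)) * _ * _ = _
    ring
  have main : (N : ℂ) ^ 2 * (∑ x ∈ phiSols p n, ∏ i, (f (x i) : ℂ)) =
      (∑ ψ, c ψ * conj (c ψ) * c ψ * conj (c ψ)) *
        (∑ φ, c φ * conj (c φ) * c φ * conj (c φ) * c φ) := by
    rw [sum_mul_sum]
    simp only [← step]
    rw [phiSols, sum_filter, mul_sum]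
    have : ∀ ψ : AddChar (G p n) ℂ, ∑ φ : AddChar (G p n) ℂ,
        ∑ x : Fin 9 → G p n, (∏ i, (f (x i) : ℂ)) * ψ (x 0 - x 1 + x 2 - x 3) *
          φ (x 4 - x 5 + x 6 - x 7 + x 8) = ∑ x : Fin 9 → G p n, ∑ φ : AddChar (G p n) ℂ,
          (∏ i, (f (x i) : ℂ)) * ψ (x 0 - x 1 + x 2 - x 3) *
          φ (x 4 - x 5 + x 6 - x 7 + x 8) := fun ψ => sum_comm
    simp only [this]
    rw [sum_comm]
    refine sum_congr rfl fun x _ => ?_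
    simp only [← mul_sum, ← sum_mul, AddChar.sum_apply_eq_ite]
    by_cases h1 : x 0 - x 1 + x 2 - x 3 = 0 <;>
      by_cases h2 : x 4 - x 5 + x 6 - x 7 + x 8 = 0
    · rw [if_pos ⟨h1, h2⟩, if_pos h1, if_pos h2]; ring
    · rw [if_neg (fun h => h2 h.2), if_neg h2]; ring
    · rw [if_neg (fun h => h1 h.1), if_neg h1]; ring
    · rw [if_neg (fun h => h1 h.1), if_neg h1]; ring
  simp only [h4] at main
  have hA : ∑ ψ, ((‖c ψ‖ ^ 4 : ℝ) : ℂ) =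
      (N : ℂ) ^ 4 * ((∑ ψ, ‖fhat f ψ‖ ^ 4 : ℝ) : ℂ) := by
    push_cast
    rw [mul_sum]
    refine sum_congr rfl fun ψ _ => ?_
    rw [hc, norm_mul, Complex.norm_natCast]; push_cast; ring
  have hB : ∑ ψ, ((‖c ψ‖ ^ 4 : ℝ) : ℂ) * c ψ =
      (N : ℂ) ^ 5 * ∑ ψ, ((‖fhat f ψ‖ ^ 4 : ℝ) : ℂ) * fhat f ψ := by
    rw [mul_sum]
    refine sum_congr rfl fun ψ _ => ?_
    rw [hc, norm_mul, Complex.norm_natCast]; push_cast; ring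
  rw [hA, hB] at main
  have main2 : ((∑ x ∈ phiSols p n, ∏ i, f (x i) : ℝ) : ℂ) =
      (((N : ℝ) ^ 7 * (∑ ψ, ‖fhat f ψ‖ ^ 4) : ℝ) : ℂ) *
        ∑ ψ, ((‖fhat f ψ‖ ^ 4 : ℝ) : ℂ) * fhat f ψ := by
    have : (N : ℂ) ^ 2 ≠ 0 := pow_ne_zero _ hN
    apply mul_left_cancel₀ this
    push_cast at main ⊢
    rw [main]; ring
  have := congrArg Complex.re main2
  rw [Complex.ofReal_re, Complex.re_ofReal_mul, Complex.re_sum] at this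
  simp only [Complex.re_ofReal_mul] at this
  rw [this, mul_assoc]

lemma phi_split (p n : ℕ) [NeZero p] (f : G p n → ℝ) :
    (∑ x ∈ phiSols p n, ∏ i, f (x i)) = (Fintype.card (G p n) : ℝ) ^ 7 *
      ((((∑ x, f x) / Fintype.card (G p n)) ^ 4 +
          ∑ ψ ∈ (univ : Finset (AddChar (G p n) ℂ)).erase 0, ‖fhat f ψ‖ ^ 4) *
        (((∑ x, f x) / Fintype.card (G p n)) ^ 5 +
          ∑ ψ ∈ (univ : Finset (AddChar (G p n) ℂ)).erase 0,
            ‖fhat f ψ‖ ^ 4 * (fhat f ψ).re)) := by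
  rw [phi_count, ← add_sum_erase univ _ (mem_univ (0 : AddChar (G p n) ℂ)),
    ← add_sum_erase univ (fun ψ => ‖fhat f ψ‖ ^ 4 * (fhat f ψ).re)
      (mem_univ (0 : AddChar (G p n) ℂ))]
  rw [fhat_zero, Complex.norm_real, Complex.ofReal_re, Real.norm_eq_abs]
  have : ∀ t : ℝ, |t| ^ 4 = t ^ 4 := fun t => Even.pow_abs (by decide) t
  rw [this, ← pow_succ]

lemma phi_card (p n : ℕ) [NeZero p] :
    ((phiSols p n).card : ℝ) = (Fintype.card (G p n) : ℝ) ^ 7 := by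
  have hN : (Fintype.card (G p n) : ℝ) ≠ 0 := by exact_mod_cast Fintype.card_ne_zero
  have h := phi_split p n (fun _ => 1)
  have h0 : ∀ ψ ∈ (univ : Finset (AddChar (G p n) ℂ)).erase 0,
      fhat (fun _ : G p n => (1 : ℝ)) ψ = 0 := by
    intro ψ hψ
    have z1 := AddChar.sum_eq_zero_iff_ne_zero.2 (ne_of_mem_erase hψ)
    simp [fhat, z1]
  have s1 : ∑ ψ ∈ (univ : Finset (AddChar (G p n) ℂ)).erase 0,
      ‖fhat (fun _ : G p n => (1 : ℝ)) ψ‖ ^ 4 = 0 :=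
    sum_eq_zero (fun ψ hψ => by rw [h0 ψ hψ]; simp)
  have s2 : ∑ ψ ∈ (univ : Finset (AddChar (G p n) ℂ)).erase 0,
      ‖fhat (fun _ : G p n => (1 : ℝ)) ψ‖ ^ 4 * (fhat (fun _ : G p n => (1 : ℝ)) ψ).re = 0 :=
    sum_eq_zero (fun ψ hψ => by rw [h0 ψ hψ]; simp)
  rw [s1, s2] at h
  simp only [prod_const_one, sum_const, nsmul_eq_mul, mul_one, card_univ, div_self hN] at h
  rw [h]; norm_num

lemma TphiL_eq (p n l : ℕ) [NeZero p] (f : G p n → ℝ) :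
    TphiL p n l f = ((∑ x, f x) / Fintype.card (G p n)) ^ l *
      ((((∑ x, f x) / Fintype.card (G p n)) ^ 4 +
          ∑ ψ ∈ (univ : Finset (AddChar (G p n) ℂ)).erase 0, ‖fhat f ψ‖ ^ 4) *
        (((∑ x, f x) / Fintype.card (G p n)) ^ 5 +
          ∑ ψ ∈ (univ : Finset (AddChar (G p n) ℂ)).erase 0,
            ‖fhat f ψ‖ ^ 4 * (fhat f ψ).re)) := by
  have hN : (Fintype.card (G p n) : ℝ) ≠ 0 := by exact_mod_cast Fintype.card_ne_zero
  have hcard : (p : ℝ) ^ n = Fintype.card (G p n) := by simp [ZMod.card]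
  rw [TphiL, phi_card, hcard]
  simp only [← mul_sum, ← Fintype.sum_pow]
  rw [← sum_mul, phi_split]
  rw [div_pow _ _ l]
  generalize ∑ ψ ∈ (univ : Finset (AddChar (G p n) ℂ)).erase 0, ‖fhat f ψ‖ ^ 4 = S
  generalize ∑ ψ ∈ (univ : Finset (AddChar (G p n) ℂ)).erase 0,
    ‖fhat f ψ‖ ^ 4 * (fhat f ψ).re = R
  generalize (∑ x, f x) / (Fintype.card (G p n) : ℝ) = a
  generalize (Fintype.card (G p n) : ℝ) = N at *
  field_simp

lemma final_ineq (l : ℕ) (a S R : ℝ) (ha : 1 / 2 ≤ a) (ha1 : a ≤ 1) (hS : 0 ≤ S)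
    (hS1 : S ≤ 1 / 36) (hR : |R| ≤ S * (1 / 3)) :
    (2 : ℝ) ^ (-((l : ℤ) + 8)) ≤ a ^ l * ((a ^ 4 + S) * (a ^ 5 + R)) +
      (1 - a) ^ l * (((1 - a) ^ 4 + S) * ((1 - a) ^ 5 - R)) := by
  set b := 1 - a with hb
  have hb0 : 0 ≤ b := by linarith
  have ha0 : 0 ≤ a := by linarith
  have hba : b ≤ a := by linarith
  have hpow : (2 : ℝ) ^ (-((l : ℤ) + 8)) ≤ a ^ l * a ^ 9 + b ^ l * b ^ 9 := by
    have := add_pow_le ha0 hb0 (l + 9)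
    rw [show a + b = 1 by linarith, one_pow, show l + 9 - 1 = l + 8 by omega] at this
    rw [zpow_neg, ← pow_add, ← pow_add]
    have e : (2 : ℝ) ^ ((l : ℤ) + 8) = 2 ^ (l + 8) := by exact_mod_cast zpow_natCast (2 : ℝ) (l + 8)
    rw [e, inv_le_iff_one_le_mul₀' (by positivity)]
    exact this
  refine hpow.trans ?_
  obtain ⟨hR1, hR2⟩ := abs_le.1 hR
  have hla : 0 ≤ a ^ l := by positivity
  have hlb : 0 ≤ b ^ l := by positivity
  rcases le_total 0 R with h | h
  · have h1 : b ^ l * (b ^ 4 + S) ≤ a ^ l * (a ^ 4 + S) := by gcongr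
    have h2 := mul_le_mul_of_nonneg_right h1 h
    have h3 : 0 ≤ a ^ l * S * a ^ 5 := by positivity
    have h4 : 0 ≤ b ^ l * S * b ^ 5 := by positivity
    nlinarith
  · have h1 : a ^ 9 ≤ (a ^ 4 + S) * (a ^ 5 + R) := by
      have h4 : (1 / 2 : ℝ) ^ 4 ≤ a ^ 4 := by gcongr
      have h5 : 0 ≤ a ^ 4 * (a - 1 / 3) - 1 / 108 := by nlinarith
      have h6 := mul_nonneg hS h5
      have h7 : (a ^ 4 + S) * (- (S * (1 / 3))) ≤ (a ^ 4 + S) * R := by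
        apply mul_le_mul_of_nonneg_left (by linarith) (by positivity)
      have h8 : S * S ≤ S * (1 / 36) := mul_le_mul_of_nonneg_left hS1 hS
      nlinarith
    have h2 : b ^ 9 ≤ (b ^ 4 + S) * (b ^ 5 - R) := by
      have e1 : 0 ≤ S * b ^ 5 := by positivity
      have e2 : 0 ≤ (b ^ 4 + S) * (-R) := mul_nonneg (by positivity) (by linarith)
      nlinarith
    exact add_le_add (mul_le_mul_of_nonneg_left h1 hla) (mul_le_mul_of_nonneg_left h2 hlb)

theorem phi_is_alon (p : ℕ) [NeZero p] (hp : p.Prime) (hodd : Odd p) :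
    ∃ l₀ : ℕ, ∀ l ≥ l₀, ∀ n ≥ 1, ∀ f : G p n → ℝ, (∀ x, 0 ≤ f x ∧ f x ≤ 1) →
      TphiL p n l f + TphiL p n l (fun x => 1 - f x) ≥ (2 : ℝ) ^ (-((l : ℤ) + 8)) := by
  refine ⟨0, fun l _ n _ f hf => ?_⟩
  have hN : (0 : ℝ) < Fintype.card (G p n) := by exact_mod_cast Fintype.card_pos
  have hKodd : Odd (Fintype.card (G p n)) := by
    have : Fintype.card (G p n) = p ^ n := by simp [ZMod.card]
    rw [this]; exact hodd.pow
  rw [TphiL_eq, TphiL_eq]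
  have hcompl : (∑ x : G p n, (1 - f x)) / (Fintype.card (G p n) : ℝ) =
      1 - (∑ x, f x) / Fintype.card (G p n) := by
    rw [sum_sub_distrib, sub_div]
    simp only [sum_const, card_univ, nsmul_eq_mul, mul_one, div_self hN.ne']
  rw [hcompl]
  have eS : ∑ ψ ∈ (univ : Finset (AddChar (G p n) ℂ)).erase 0, ‖fhat (fun x => 1 - f x) ψ‖ ^ 4 =
      ∑ ψ ∈ (univ : Finset (AddChar (G p n) ℂ)).erase 0, ‖fhat f ψ‖ ^ 4 :=
    sum_congr rfl fun ψ hψ => by rw [fhat_compl f ψ (ne_of_mem_erase hψ), norm_neg]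
  have eR : ∑ ψ ∈ (univ : Finset (AddChar (G p n) ℂ)).erase 0,
        ‖fhat (fun x => 1 - f x) ψ‖ ^ 4 * (fhat (fun x => 1 - f x) ψ).re =
      - ∑ ψ ∈ (univ : Finset (AddChar (G p n) ℂ)).erase 0, ‖fhat f ψ‖ ^ 4 * (fhat f ψ).re := by
    rw [← sum_neg_distrib]
    exact sum_congr rfl fun ψ hψ => by
      rw [fhat_compl f ψ (ne_of_mem_erase hψ), norm_neg, Complex.neg_re, mul_neg]
  rw [eS, eR]
  have hM : ∀ ψ ∈ (univ : Finset (AddChar (G p n) ℂ)).erase 0, ‖fhat f ψ‖ ≤ 1 / 3 :=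
    fun ψ hψ => fhat_bound hKodd f hf ψ (ne_of_mem_erase hψ)
  have hV : ∑ ψ ∈ (univ : Finset (AddChar (G p n) ℂ)).erase 0, ‖fhat f ψ‖ ^ 2 ≤ 1 / 4 := by
    have h1 := parseval f
    rw [← add_sum_erase univ _ (mem_univ (0 : AddChar (G p n) ℂ)), fhat_zero, Complex.norm_real,
      Real.norm_eq_abs, sq_abs] at h1
    have h2 : (∑ x, f x ^ 2) / (Fintype.card (G p n) : ℝ) ≤ (∑ x, f x) / Fintype.card (G p n) := by
      gcongr with x
      nlinarith [(hf x).1, (hf x).2]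
    nlinarith [sq_nonneg ((∑ x, f x) / (Fintype.card (G p n) : ℝ) - 1 / 2)]
  have hS1 : ∑ ψ ∈ (univ : Finset (AddChar (G p n) ℂ)).erase 0, ‖fhat f ψ‖ ^ 4 ≤ 1 / 36 := by
    calc _ ≤ ∑ ψ ∈ (univ : Finset (AddChar (G p n) ℂ)).erase 0, (1 / 3) ^ 2 * ‖fhat f ψ‖ ^ 2 := by
          refine sum_le_sum fun ψ hψ => ?_
          rw [show (4 : ℕ) = 2 + 2 by rfl, pow_add]
          have := hM ψ hψ
          gcongr
      _ ≤ _ := by rw [← mul_sum]; linarith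
  have hR : |∑ ψ ∈ (univ : Finset (AddChar (G p n) ℂ)).erase 0, ‖fhat f ψ‖ ^ 4 * (fhat f ψ).re| ≤
      (∑ ψ ∈ (univ : Finset (AddChar (G p n) ℂ)).erase 0, ‖fhat f ψ‖ ^ 4) * (1 / 3) := by
    rw [sum_mul]
    refine (abs_sum_le_sum_abs _ _).trans (sum_le_sum fun ψ hψ => ?_)
    rw [abs_mul, abs_of_nonneg (by positivity : 0 ≤ ‖fhat f ψ‖ ^ 4)]
    exact mul_le_mul_of_nonneg_left ((Complex.abs_re_le_norm _).trans (hM ψ hψ)) (by positivity)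
  have hS : 0 ≤ ∑ ψ ∈ (univ : Finset (AddChar (G p n) ℂ)).erase 0, ‖fhat f ψ‖ ^ 4 :=
    sum_nonneg fun _ _ => by positivity
  have ha0 : 0 ≤ (∑ x, f x) / (Fintype.card (G p n) : ℝ) :=
    div_nonneg (sum_nonneg fun x _ => (hf x).1) hN.le
  have ha1 : (∑ x, f x) / (Fintype.card (G p n) : ℝ) ≤ 1 := by
    rw [div_le_one hN]
    calc ∑ x, f x ≤ ∑ _x : G p n, (1 : ℝ) := sum_le_sum fun x _ => (hf x).2
      _ = _ := by simp only [sum_const, card_univ, nsmul_eq_mul, mul_one]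
  generalize ∑ ψ ∈ (univ : Finset (AddChar (G p n) ℂ)).erase 0, ‖fhat f ψ‖ ^ 4 = S at *
  generalize ∑ ψ ∈ (univ : Finset (AddChar (G p n) ℂ)).erase 0,
    ‖fhat f ψ‖ ^ 4 * (fhat f ψ).re = R at *
  generalize (∑ x, f x) / (Fintype.card (G p n) : ℝ) = a at *
  rcases le_total (1 / 2) a with h | h
  · exact final_ineq l a S R h ha1 hS hS1 hR
  · have := final_ineq l (1 - a) S (-R) (by linarith) (by linarith) hS hS1 (by rwa [abs_neg])
    rw [sub_sub_cancel, sub_neg_eq_add] at this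
    rw [ge_iff_le, add_comm (a ^ l * _)]
    exact this
end

section
/- Let p be an odd prime. For every n ≥ 1 and every f : 𝔽_p^n → ℝ with 0 ≤ f ≤ 1 and 𝔼f = 1/2, we have T_Φ(f)·T_Φ(1 − f) ≥ 2^{−18}. (In other words, the system Φ is geometrically common.) -/
open Finset

/-- `T_Φ(f)`: the average of `f(x₁)⋯f(x₉)` over solutions of `Φ`. -/
noncomputable def Tphi (p n : ℕ) [NeZero p] (f : G p n → ℝ) : ℝ :=
  (∑ x ∈ phiSols p n, ∏ i, f (x i)) / (phiSols p n).card

/-- `𝔼f`, the average of `f` over `𝔽_p^n`. -/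
noncomputable def expect (p n : ℕ) [NeZero p] (f : G p n → ℝ) : ℝ :=
  (∑ x, f x) / (p : ℝ) ^ n

/-- Unnormalised Fourier coefficient. -/
noncomputable def fc {p n : ℕ} [NeZero p] (f : G p n → ℝ) (ψ : AddChar (G p n) ℂ) : ℂ :=
  ∑ x, (f x : ℂ) * ψ x

lemma fc_neg {p n : ℕ} [NeZero p] (f : G p n → ℝ) (ψ : AddChar (G p n) ℂ) :
    fc f (-ψ) = (starRingEnd ℂ) (fc f ψ) := by
  unfold fc
  rw [map_sum]
  refine Finset.sum_congr rfl fun x _ => ?_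
  rw [map_mul, Complex.conj_ofReal, AddChar.neg_apply, AddChar.map_neg_eq_conj]

lemma fc_mul_neg {p n : ℕ} [NeZero p] (f : G p n → ℝ) (ψ : AddChar (G p n) ℂ) :
    fc f ψ * fc f (-ψ) = ((‖fc f ψ‖ ^ 2 : ℝ) : ℂ) := by
  rw [fc_neg, Complex.mul_conj, Complex.normSq_eq_norm_sq]

lemma count_formula {p n : ℕ} [NeZero p] (f : G p n → ℝ) :
    (Fintype.card (G p n) : ℂ) ^ 2 * ((∑ x ∈ phiSols p n, ∏ i, f (x i) : ℝ) : ℂ) =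
      (∑ ψ : AddChar (G p n) ℂ, ((‖fc f ψ‖ ^ 4 : ℝ) : ℂ)) *
      ∑ ψ : AddChar (G p n) ℂ, ((‖fc f ψ‖ ^ 4 : ℝ) : ℂ) * fc f ψ := by
  have h1 : ∀ ψ χ : AddChar (G p n) ℂ,
      ((‖fc f ψ‖ ^ 4 : ℝ) : ℂ) * (((‖fc f χ‖ ^ 4 : ℝ) : ℂ) * fc f χ) =
      ∑ x : Fin 9 → G p n, (∏ i, (f (x i) : ℂ)) *
        (ψ (x 0 - x 1 + x 2 - x 3) * χ (x 4 - x 5 + x 6 - x 7 + x 8)) := by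
    intro ψ χ
    have e : ∀ φ : AddChar (G p n) ℂ, ((‖fc f φ‖ ^ 4 : ℝ) : ℂ) =
        fc f φ * fc f (-φ) * (fc f φ * fc f (-φ)) := by
      intro φ
      rw [fc_mul_neg]
      push_cast
      ring
    rw [e, e]
    have h := Finset.prod_univ_sum (fun _ : Fin 9 => (Finset.univ : Finset (G p n)))
      (fun i y => (f y : ℂ) * (![ψ, -ψ, ψ, -ψ, χ, -χ, χ, -χ, χ] i) y)
    rw [Fintype.piFinset_univ] at h
    have h2 : ∏ i : Fin 9, ∑ y : G p n, (f y : ℂ) * (![ψ, -ψ, ψ, -ψ, χ, -χ, χ, -χ, χ] i) y =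
        ∏ i : Fin 9, fc f (![ψ, -ψ, ψ, -ψ, χ, -χ, χ, -χ, χ] i) := rfl
    rw [h2] at h
    have h3 : ∏ i : Fin 9, fc f (![ψ, -ψ, ψ, -ψ, χ, -χ, χ, -χ, χ] i) =
        fc f ψ * fc f (-ψ) * (fc f ψ * fc f (-ψ)) *
        (fc f χ * fc f (-χ) * (fc f χ * fc f (-χ)) * fc f χ) := by
      simp [Fin.prod_univ_succ]
      ring
    rw [← h3, h]
    refine Finset.sum_congr rfl fun x _ => ?_
    rw [Finset.prod_mul_distrib]
    congr 1
    simp only [sub_eq_add_neg, AddChar.map_add_eq_mul]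
    simp [Fin.prod_univ_succ]
    simp only [show (5 : Fin 9) = Fin.succ 4 from rfl]
    ring_nf
    try rfl
  rw [Finset.sum_mul_sum]
  simp_rw [h1]
  have h4 : ∀ x : Fin 9 → G p n,
      ∑ ψ : AddChar (G p n) ℂ, ∑ χ : AddChar (G p n) ℂ, (∏ i, (f (x i) : ℂ)) *
        (ψ (x 0 - x 1 + x 2 - x 3) * χ (x 4 - x 5 + x 6 - x 7 + x 8)) =
      if x ∈ phiSols p n then (Fintype.card (G p n) : ℂ) ^ 2 * (∏ i, (f (x i) : ℂ)) else 0 := by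
    intro x
    simp_rw [← Finset.mul_sum, ← Finset.sum_mul, AddChar.sum_apply_eq_ite]
    simp only [phiSols, Finset.mem_filter, Finset.mem_univ, true_and]
    split_ifs <;> first | ring1 | (exfalso; tauto)
  calc _ = ∑ x : Fin 9 → G p n, ∑ ψ : AddChar (G p n) ℂ, ∑ χ : AddChar (G p n) ℂ,
        (∏ i, (f (x i) : ℂ)) *
        (ψ (x 0 - x 1 + x 2 - x 3) * χ (x 4 - x 5 + x 6 - x 7 + x 8)) := by
        simp_rw [h4]
        rw [← Finset.sum_filter, Finset.filter_mem_eq_inter, Finset.univ_inter]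
        push_cast
        rw [Finset.mul_sum]
    _ = _ := by
        rw [Finset.sum_comm]
        refine Finset.sum_congr rfl fun ψ _ => ?_
        rw [Finset.sum_comm]

lemma fc_one {p n : ℕ} [NeZero p] (ψ : AddChar (G p n) ℂ) :
    fc (fun _ => 1) ψ = if ψ = 0 then (Fintype.card (G p n) : ℂ) else 0 := by
  unfold fc
  simp [AddChar.sum_eq_ite]

lemma card_sols {p n : ℕ} [NeZero p] :
    ((phiSols p n).card : ℂ) = (Fintype.card (G p n) : ℂ) ^ 7 := by
  have h := count_formula (p := p) (n := n) (fun _ => 1)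
  have hN : (Fintype.card (G p n) : ℂ) ≠ 0 := by exact_mod_cast Fintype.card_ne_zero
  simp only [fc_one] at h
  rw [Finset.sum_eq_single (0 : AddChar (G p n) ℂ) (by intro b _ hb; simp [hb]) (by simp),
    Finset.sum_eq_single (0 : AddChar (G p n) ℂ) (by intro b _ hb; simp [hb]) (by simp)] at h
  simp only [if_true, Finset.prod_const_one, Finset.sum_const, nsmul_eq_mul, mul_one,
    Complex.norm_natCast] at h
  have h2 : (Fintype.card (G p n) : ℂ) ^ 2 * ((phiSols p n).card : ℂ) =
      (Fintype.card (G p n) : ℂ) ^ 2 * (Fintype.card (G p n) : ℂ) ^ 7 := by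
    push_cast at h ⊢
    rw [h]; ring
  exact mul_left_cancel₀ (pow_ne_zero 2 hN) h2

lemma Tphi_formula {p n : ℕ} [NeZero p] (f : G p n → ℝ) :
    Tphi p n f * (Fintype.card (G p n) : ℝ) ^ 9 =
      (∑ ψ : AddChar (G p n) ℂ, ‖fc f ψ‖ ^ 4) *
      ∑ ψ : AddChar (G p n) ℂ, ‖fc f ψ‖ ^ 4 * (fc f ψ).re := by
  have h := count_formula f
  have hc : ((phiSols p n).card : ℝ) = (Fintype.card (G p n) : ℝ) ^ 7 := by
    have := card_sols (p := p) (n := n)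
    exact_mod_cast this
  have hN : (Fintype.card (G p n) : ℝ) ≠ 0 := by exact_mod_cast Fintype.card_ne_zero
  have h2 := congrArg Complex.re h
  rw [← Complex.ofReal_sum] at h2
  rw [Complex.re_ofReal_mul, Complex.re_sum] at h2
  simp only [Complex.re_ofReal_mul] at h2
  rw [← h2, Tphi, hc]
  have e : ∀ r : ℝ, (((Fintype.card (G p n) : ℂ) ^ 2 * (r : ℂ)).re) =
    (Fintype.card (G p n) : ℝ) ^ 2 * r := by
    intro r
    rw [show ((Fintype.card (G p n) : ℂ) ^ 2 * (r : ℂ)) =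
      (((Fintype.card (G p n) : ℝ) ^ 2 * r : ℝ) : ℂ) by push_cast; ring, Complex.ofReal_re]
  rw [e]
  field_simp

lemma parseval_s6 {p n : ℕ} [NeZero p] (f : G p n → ℝ) :
    ∑ ψ : AddChar (G p n) ℂ, ‖fc f ψ‖ ^ 2 = (Fintype.card (G p n) : ℝ) * ∑ x, f x ^ 2 := by
  have : ∑ ψ : AddChar (G p n) ℂ, ((‖fc f ψ‖ ^ 2 : ℝ) : ℂ) =
      (Fintype.card (G p n) : ℂ) * ∑ x, (f x : ℂ) ^ 2 := by
    simp_rw [← fc_mul_neg]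
    unfold fc
    simp_rw [Finset.sum_mul_sum]
    rw [Finset.sum_comm, Finset.mul_sum]
    refine Finset.sum_congr rfl fun x _ => ?_
    rw [Finset.sum_comm]
    have h : ∀ y : G p n, ∑ ψ : AddChar (G p n) ℂ, (f x : ℂ) * ψ x * ((f y : ℂ) * (-ψ) y) =
        if x = y then (f x : ℂ) * f y * (Fintype.card (G p n) : ℂ) else 0 := by
      intro y
      have e : ∀ ψ : AddChar (G p n) ℂ, (f x : ℂ) * ψ x * ((f y : ℂ) * (-ψ) y) =
          (f x : ℂ) * f y * ψ (x - y) := by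
        intro ψ
        rw [sub_eq_add_neg, AddChar.map_add_eq_mul, AddChar.neg_apply]
        ring
      simp_rw [e]
      rw [← Finset.mul_sum, AddChar.sum_apply_eq_ite]
      simp only [sub_eq_zero]
      split_ifs <;> simp
    simp_rw [h]
    simp
    ring
  exact_mod_cast this

lemma neg_ne {p n : ℕ} [NeZero p] (hodd : Odd p) (ψ : AddChar (G p n) ℂ) (h : ψ ≠ 0) :
    -ψ ≠ ψ := by
  intro e
  apply h
  obtain ⟨k, hk⟩ := hodd
  ext x
  have h1 : ψ x * ψ x = 1 := by
    have h2 : ψ (-x) = ψ x := by rw [← AddChar.neg_apply, e]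
    nth_rewrite 1 [← h2]
    rw [← AddChar.map_add_eq_mul]
    simp
  have h3 : (p : ℕ) • x = 0 := by
    funext i
    simp
  have h4 : ψ x ^ p = 1 := by rw [← AddChar.map_nsmul_eq_pow, h3, AddChar.map_zero_eq_one]
  have h5 : ψ x ^ (2 * k + 1) = 1 := (congrArg (fun m => ψ x ^ m) hk).symm.trans h4
  rw [pow_succ, pow_mul, pow_two, h1] at h5
  simpa using h5

lemma final_ineq_s6 (s t : ℝ) (hs : 0 ≤ s) (hs1 : s ≤ 1 / 32) (ht : |t| ≤ 3 / 8 * s) :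
    (1 / 2 ^ 18 : ℝ) ≤ (1 / 16 + s) ^ 2 * ((1 / 32 + t) * (1 / 32 - t)) := by
  have h1 : t ^ 2 ≤ (3 / 8 * s) ^ 2 := by
    rw [← sq_abs t]; gcongr
  have h2 : (1 / 16 + s) ^ 2 * (1 / 1024 - (3 / 8 * s) ^ 2) ≤
      (1 / 16 + s) ^ 2 * ((1 / 32 + t) * (1 / 32 - t)) := by
    gcongr; nlinarith
  refine le_trans ?_ h2
  have h3 : s ^ 2 ≤ 1 / 32 * s := by nlinarith
  have h4 : (1 / 16 + s) ^ 2 ≤ (3 / 32) ^ 2 := by gcongr; linarith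
  have h5 : (1 / 16 + s) ^ 2 * s ^ 2 ≤ (3 / 32) ^ 2 * (1 / 32 * s) := by gcongr
  nlinarith

theorem phi_geometrically_common (p : ℕ) [NeZero p] (hp : p.Prime) (hodd : Odd p)
    (n : ℕ) (hn : 1 ≤ n) (f : G p n → ℝ) (hf : ∀ x, 0 ≤ f x ∧ f x ≤ 1)
    (hmean : expect p n f = 1 / 2) :
    Tphi p n f * Tphi p n (fun x => 1 - f x) ≥ (2 : ℝ) ^ (-18 : ℤ) := by
  have hcard : (Fintype.card (G p n) : ℝ) = (p : ℝ) ^ n := by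
    simp [ZMod.card]
  set N : ℝ := (Fintype.card (G p n) : ℝ) with hNdef
  have hN : 0 < N := by rw [hNdef]; exact_mod_cast Fintype.card_pos
  have hsum : ∑ x, f x = N / 2 := by
    rw [_root_.expect, ← hcard] at hmean
    field_simp at hmean
    linarith
  set E : Finset (AddChar (G p n) ℂ) := Finset.univ.erase 0 with hE
  have f0 : fc f 0 = ((N / 2 : ℝ) : ℂ) := by
    rw [← hsum]; simp [fc]
  have g0 : fc (fun x => 1 - f x) 0 = ((N / 2 : ℝ) : ℂ) := by
    have : ∑ x, (1 - f x) = N / 2 := by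
      rw [Finset.sum_sub_distrib, hsum]
      simp only [Finset.sum_const, Finset.card_univ, nsmul_eq_mul, mul_one]
      linarith
    rw [← this]; simp [fc]
  have gψ : ∀ ψ ∈ E, fc (fun x => 1 - f x) ψ = - fc f ψ := by
    intro ψ hψ
    have h := fc_one ψ
    rw [if_neg (Finset.ne_of_mem_erase hψ)] at h
    simp only [fc] at h ⊢
    rw [← zero_sub, ← h, ← Finset.sum_sub_distrib]
    refine Finset.sum_congr rfl fun x _ => ?_
    push_cast; ring
  have split : ∀ F : AddChar (G p n) ℂ → ℝ, ∑ ψ, F ψ = F 0 + ∑ ψ ∈ E, F ψ := fun F =>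
    (Finset.add_sum_erase _ F (Finset.mem_univ 0)).symm
  have nf0 : ‖((N / 2 : ℝ) : ℂ)‖ = N / 2 := by
    rw [Complex.norm_real, Real.norm_of_nonneg (by positivity)]
  -- Parseval
  have hP : ∑ ψ ∈ E, ‖fc f ψ‖ ^ 2 ≤ N ^ 2 / 4 := by
    have h := parseval_s6 f
    rw [split, f0, nf0, ← hNdef] at h
    have h2 : ∑ x, f x ^ 2 ≤ N / 2 := by
      rw [← hsum]
      refine Finset.sum_le_sum fun x _ => ?_
      nlinarith [hf x]
    nlinarith
  have hmax : ∀ ψ ∈ E, ‖fc f ψ‖ ^ 2 ≤ N ^ 2 / 8 := by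
    intro ψ hψ
    have h0 := Finset.ne_of_mem_erase hψ
    have hne := neg_ne hodd ψ h0
    have hsub : ({-ψ, ψ} : Finset (AddChar (G p n) ℂ)) ⊆ E := by
      intro χ hχ
      simp only [Finset.mem_insert, Finset.mem_singleton] at hχ
      rcases hχ with rfl | rfl
      · simp [hE, h0]
      · exact hψ
    have h := Finset.sum_le_sum_of_subset_of_nonneg hsub
      (f := fun ψ => ‖fc f ψ‖ ^ 2) (fun _ _ _ => by positivity)
    rw [Finset.sum_pair hne, fc_neg, RCLike.norm_conj] at h
    linarith
  have hmax' : ∀ ψ ∈ E, ‖fc f ψ‖ ≤ 3 / 8 * N := by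
    intro ψ hψ
    refine abs_le_of_sq_le_sq' ?_ (by positivity) |>.2
    nlinarith [hmax ψ hψ]
  set s := ∑ ψ ∈ E, ‖fc f ψ‖ ^ 4 with hs
  set t := ∑ ψ ∈ E, ‖fc f ψ‖ ^ 4 * (fc f ψ).re with ht
  have hs0 : 0 ≤ s := Finset.sum_nonneg fun _ _ => by positivity
  have hs1 : s ≤ N ^ 4 / 32 := by
    calc s ≤ ∑ ψ ∈ E, N ^ 2 / 8 * ‖fc f ψ‖ ^ 2 := by
          refine Finset.sum_le_sum fun ψ hψ => ?_
          nlinarith [hmax ψ hψ, sq_nonneg ‖fc f ψ‖]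
      _ ≤ N ^ 2 / 8 * (N ^ 2 / 4) := by
          rw [← Finset.mul_sum]; gcongr
      _ = _ := by ring
  have ht1 : |t| ≤ 3 / 8 * N * s := by
    calc |t| ≤ ∑ ψ ∈ E, |‖fc f ψ‖ ^ 4 * (fc f ψ).re| := Finset.abs_sum_le_sum_abs _ _
      _ ≤ ∑ ψ ∈ E, 3 / 8 * N * ‖fc f ψ‖ ^ 4 := by
          refine Finset.sum_le_sum fun ψ hψ => ?_
          rw [abs_mul, abs_of_nonneg (by positivity : 0 ≤ ‖fc f ψ‖ ^ 4), mul_comm]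
          gcongr
          exact (Complex.abs_re_le_norm _).trans (hmax' ψ hψ)
      _ = _ := by rw [← Finset.mul_sum]
  have T1 := Tphi_formula f
  have T2 := Tphi_formula (fun x => 1 - f x)
  rw [split, split, f0, nf0, Complex.ofReal_re, ← hNdef, ← hs, ← ht] at T1
  rw [split, split, g0, nf0, Complex.ofReal_re, ← hNdef] at T2
  rw [Finset.sum_congr rfl (fun ψ hψ => by rw [gψ ψ hψ, norm_neg] :
      ∀ ψ ∈ E, ‖fc (fun x => 1 - f x) ψ‖ ^ 4 = ‖fc f ψ‖ ^ 4),
    Finset.sum_congr rfl (fun ψ hψ => by rw [gψ ψ hψ, norm_neg, Complex.neg_re, mul_neg] :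
      ∀ ψ ∈ E, ‖fc (fun x => 1 - f x) ψ‖ ^ 4 * (fc (fun x => 1 - f x) ψ).re =
        -(‖fc f ψ‖ ^ 4 * (fc f ψ).re)), Finset.sum_neg_distrib, ← hs, ← ht] at T2
  have key := final_ineq_s6 (s / N ^ 4) (t / N ^ 5) (by positivity)
    (by rw [div_le_iff₀ (by positivity)]; linarith)
    (by
      rw [abs_div, abs_of_pos (by positivity : 0 < N ^ 5), div_le_iff₀ (by positivity)]
      refine ht1.trans (le_of_eq ?_)
      field_simp)
  have e1 : Tphi p n f = (1 / 16 + s / N ^ 4) * (1 / 32 + t / N ^ 5) := by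
    rw [eq_div_of_mul_eq (by positivity) T1]
    field_simp
    ring
  have e2 : Tphi p n (fun x => 1 - f x) = (1 / 16 + s / N ^ 4) * (1 / 32 - t / N ^ 5) := by
    rw [eq_div_of_mul_eq (by positivity) T2]
    field_simp
    ring
  rw [e1, e2, ge_iff_le]
  have e3 : (2 : ℝ) ^ (-18 : ℤ) = 1 / 2 ^ 18 := by norm_num
  rw [e3]
  refine key.trans (le_of_eq ?_)
  ring
end

section
/- Let p be a prime and let M be an m × t matrix over 𝔽_p of rank m with m < t, such that for each coordinate i ∈ {1,…,t} the kernel of M in 𝔽_p^t is not contained in the hyperplane {v : v_i = 0}. If the system M is 1/2-prevalent, then it is geometrically common if and only if it is weakly Alon. -/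
open Finset

/-- The set of solutions in `(𝔽_p^n)^t` of the linear system given by the matrix `M`. -/
def sols (p : ℕ) [NeZero p] {m t : ℕ} (M : Matrix (Fin m) (Fin t) (ZMod p)) (n : ℕ) :
    Finset (Fin t → G p n) :=
  Finset.univ.filter fun x => ∀ j, ∑ i, M j i • x i = 0

/-- `T_M(f)`: the average of `∏ᵢ f(xᵢ)` over solutions of the system `M`. -/
noncomputable def TM (p : ℕ) [NeZero p] {m t : ℕ} (M : Matrix (Fin m) (Fin t) (ZMod p))
    (n : ℕ) (f : G p n → ℝ) : ℝ :=
  (∑ x ∈ sols p M n, ∏ i, f (x i)) / (sols p M n).card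

/-- The system `M` is `1/2`-prevalent: there is `c > 0` such that every `[0,1]`-valued
function of mean `1/2` has solution density at least `c`. -/
def IsHalfPrevalent (p : ℕ) [NeZero p] {m t : ℕ} (M : Matrix (Fin m) (Fin t) (ZMod p)) :
    Prop :=
  ∃ c > (0 : ℝ), ∀ n ≥ 1, ∀ f : G p n → ℝ, (∀ x, 0 ≤ f x ∧ f x ≤ 1) →
    expect p n f = 1 / 2 → TM p M n f ≥ c

/-- The system `M` is geometrically common: for every `[0,1]`-valued function of
mean `1/2`, the product `T_M(f)·T_M(1−f)` is at least `2^{−2t}`. -/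
def IsGeometricallyCommon (p : ℕ) [NeZero p] {m t : ℕ}
    (M : Matrix (Fin m) (Fin t) (ZMod p)) : Prop :=
  ∀ n ≥ 1, ∀ f : G p n → ℝ, (∀ x, 0 ≤ f x ∧ f x ≤ 1) → expect p n f = 1 / 2 →
    TM p M n f * TM p M n (fun x => 1 - f x) ≥ (2 : ℝ) ^ (-(2 * (t : ℤ)))

/-- The system `M` is weakly Alon: for every `ε > 0`, for all sufficiently large `l`,
the system obtained by adding `l` free variables is common up to a loss of `ε·2^{−l}`. -/
def IsWeaklyAlon (p : ℕ) [NeZero p] {m t : ℕ} (M : Matrix (Fin m) (Fin t) (ZMod p)) :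
    Prop :=
  ∀ ε > (0 : ℝ), ∃ l₀ : ℕ, ∀ l ≥ l₀, ∀ n ≥ 1, ∀ f : G p n → ℝ,
    (∀ x, 0 ≤ f x ∧ f x ≤ 1) →
    (expect p n f) ^ l * TM p M n f + (1 - expect p n f) ^ l * TM p M n (fun x => 1 - f x) >
      (2 : ℝ) ^ (-(l : ℤ)) * ((2 : ℝ) ^ (1 - (t : ℤ)) - ε)


lemma prod_sub_prod_le {ι : Type*} (s : Finset ι) (u w : ι → ℝ) (hu : ∀ i, 0 ≤ u i)
    (huw : ∀ i, u i ≤ w i) (hw : ∀ i, w i ≤ 1) :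
    ∏ i ∈ s, w i - ∏ i ∈ s, u i ≤ ∑ i ∈ s, (w i - u i) := by
  classical
  induction s using Finset.induction_on with
  | empty => simp
  | insert a s ha ih =>
    rw [Finset.prod_insert ha, Finset.prod_insert ha, Finset.sum_insert ha]
    have h0 : 0 ≤ ∏ i ∈ s, u i := Finset.prod_nonneg fun i _ => hu i
    have h1 : ∏ i ∈ s, u i ≤ 1 :=
      Finset.prod_le_one (fun i _ => hu i) (fun i _ => (huw i).trans (hw i))
    have h2 : ∏ i ∈ s, u i ≤ ∏ i ∈ s, w i :=
      Finset.prod_le_prod (fun i _ => hu i) (fun i _ => huw i)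
    nlinarith [mul_nonneg (sub_nonneg.2 (hw a)) (sub_nonneg.2 h2),
      mul_nonneg (sub_nonneg.2 (huw a)) (sub_nonneg.2 h1)]

section
variable (p : ℕ) [NeZero p] {m t : ℕ} (M : Matrix (Fin m) (Fin t) (ZMod p)) (n : ℕ)

lemma sols_card_pos : (0 : ℝ) < (sols p M n).card := by
  have : (0 : Fin t → G p n) ∈ sols p M n := by simp [sols]
  exact_mod_cast Finset.card_pos.2 ⟨_, this⟩

lemma TM_nonneg (f : G p n → ℝ) (hf : ∀ x, 0 ≤ f x) : 0 ≤ TM p M n f :=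
  div_nonneg (Finset.sum_nonneg fun _ _ => Finset.prod_nonneg fun _ _ => hf _) (Nat.cast_nonneg _)

lemma TM_le_one (f : G p n → ℝ) (hf : ∀ x, 0 ≤ f x ∧ f x ≤ 1) : TM p M n f ≤ 1 := by
  unfold TM
  rw [div_le_one (sols_card_pos p M n)]
  calc _ ≤ ∑ x ∈ sols p M n, (1 : ℝ) := Finset.sum_le_sum fun x _ =>
        Finset.prod_le_one (fun i _ => (hf _).1) (fun i _ => (hf _).2)
    _ = _ := by simp

lemma TM_smul (c : ℝ) (f : G p n → ℝ) : TM p M n (fun x => c * f x) = c ^ t * TM p M n f := by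
  unfold TM
  simp only [Finset.prod_mul_distrib, Finset.prod_const, Finset.card_univ, Fintype.card_fin]
  rw [← Finset.mul_sum, mul_div_assoc]

lemma expect_smul (c : ℝ) (f : G p n → ℝ) :
    expect p n (fun x => c * f x) = c * expect p n f := by
  unfold _root_.expect
  rw [← Finset.mul_sum, mul_div_assoc]

lemma pn_pos : (0 : ℝ) < (p : ℝ) ^ n := by
  have := NeZero.pos p
  positivity

lemma expect_one_sub (f : G p n → ℝ) :
    expect p n (fun x => 1 - f x) = 1 - expect p n f := by
  unfold _root_.expect
  have := pn_pos p n
  rw [Finset.sum_sub_distrib, sub_div]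
  congr 1
  simp [Finset.card_univ, ZMod.card]

lemma expect_sub (f g : G p n → ℝ) :
    expect p n (fun x => f x - g x) = expect p n f - expect p n g := by
  unfold _root_.expect
  rw [Finset.sum_sub_distrib, sub_div]

lemma expect_nonneg' (f : G p n → ℝ) (hf : ∀ x, 0 ≤ f x) : 0 ≤ expect p n f :=
  div_nonneg (Finset.sum_nonneg fun _ _ => hf _) (pn_pos p n).le

lemma marginal (hp : p.Prime) (i : Fin t)
    (hker : ∃ v : Fin t → ZMod p, M.mulVec v = 0 ∧ v i ≠ 0) (h : G p n → ℝ) :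
    ∑ x ∈ sols p M n, h (x i) = (sols p M n).card * expect p n h := by
  have : Fact p.Prime := ⟨hp⟩
  obtain ⟨v, hv, hvi⟩ := hker
  have hM : ∀ y : G p n, ∀ j, ∑ k, M j k • (v k • y) = 0 := by
    intro y j
    have := congrFun hv j
    simp only [Matrix.mulVec, dotProduct, Pi.zero_apply] at this
    simp only [smul_smul, ← Finset.sum_smul, this, zero_smul]
  have key : ∀ y : G p n, ∑ x ∈ sols p M n, h (x i) = ∑ x ∈ sols p M n, h (x i + v i • y) := by
    intro y
    symm
    refine Finset.sum_bij' (fun x _ => fun k => x k + v k • y) (fun x _ => fun k => x k - v k • y)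
      ?_ ?_ ?_ ?_ ?_
    · intro x hx
      simp only [sols, Finset.mem_filter, Finset.mem_univ, true_and] at hx ⊢
      intro j
      simp only [smul_add, Finset.sum_add_distrib, hx j, hM y j, add_zero]
    · intro x hx
      simp only [sols, Finset.mem_filter, Finset.mem_univ, true_and] at hx ⊢
      intro j
      simp only [smul_sub, Finset.sum_sub_distrib, hx j, hM y j, sub_zero]
    · intro x hx; funext k; simp
    · intro x hx; funext k; simp
    · intro x hx; rfl
  have h2 : ∀ z : G p n, ∑ y : G p n, h (z + v i • y) = ∑ y, h y := by
    intro z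
    refine Fintype.sum_bijective (fun y : G p n => z + v i • y) ?_ _ _ (fun _ => rfl)
    refine (Finite.injective_iff_bijective).1 ?_
    intro a b hab
    have : v i • a = v i • b := add_left_cancel hab
    exact smul_right_injective _ hvi this
  have h3 : ∑ y : G p n, ∑ x ∈ sols p M n, h (x i) = ∑ y : G p n, ∑ x ∈ sols p M n, h (x i + v i • y) :=
    Finset.sum_congr rfl fun y _ => key y
  replace h3 := h3.trans Finset.sum_comm
  simp only [h2, Finset.sum_const, Finset.card_univ, Fintype.card_fun, ZMod.card,
    Fintype.card_fin, nsmul_eq_mul, Nat.cast_pow] at h3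
  unfold _root_.expect
  have := pn_pos p n
  field_simp
  linarith

lemma TM_sub_le (hp : p.Prime)
    (hker : ∀ i : Fin t, ∃ v : Fin t → ZMod p, M.mulVec v = 0 ∧ v i ≠ 0)
    (u w : G p n → ℝ) (hu : ∀ x, 0 ≤ u x) (huw : ∀ x, u x ≤ w x) (hw : ∀ x, w x ≤ 1) :
    TM p M n w - TM p M n u ≤ t * (expect p n w - expect p n u) := by
  unfold TM
  have hc := sols_card_pos p M n
  rw [← sub_div, div_le_iff₀ hc, ← Finset.sum_sub_distrib]
  calc _ ≤ ∑ x ∈ sols p M n, ∑ i, (w (x i) - u (x i)) := Finset.sum_le_sum fun x _ =>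
        prod_sub_prod_le _ _ _ (fun i => hu _) (fun i => huw _) (fun i => hw _)
    _ = ∑ i : Fin t, ∑ x ∈ sols p M n, (w (x i) - u (x i)) := Finset.sum_comm
    _ = ∑ i : Fin t, ((sols p M n).card : ℝ) * expect p n (fun z => w z - u z) :=
        Finset.sum_congr rfl fun i _ => marginal p M n hp i (hker i) (fun z => w z - u z)
    _ = _ := by
        rw [expect_sub]; simp; ring

end

lemma core_real (c K ε τ : ℝ) (hc : 0 < c) (hK : 0 < K) (hε : 0 < ε) (hτ : 0 ≤ τ) :
    ∃ l₀ : ℕ, ∀ l ≥ l₀, ∀ x a b a0 b0 : ℝ, 0 ≤ x → x ≤ 1 → c ≤ a0 → a0 ≤ 1 → a0 ≤ a → 0 ≤ b →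
      b0 - τ * x ≤ b → K ^ 2 ≤ a0 * b0 →
      (1 + x) ^ l * a + (1 - x) ^ l * b > 2 * K - ε := by
  set e := min ε K with he
  have he0 : 0 < e := lt_min hε hK
  have heK : e ≤ K := min_le_right _ _
  have heε : e ≤ ε := min_le_left _ _
  set C := 2 * K / c with hC
  have hC0 : 0 < C := by positivity
  set D := C * K ^ 2 + τ with hD
  have hD0 : 0 < D := by positivity
  obtain ⟨l₀, hl₀⟩ := exists_nat_gt (4 * D * C / (3 * K * e))
  refine ⟨l₀, ?_⟩
  intro l hl x a b a0 b0 hx0 hx1 hca ha1 haa hb hbb hab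
  have hll : 4 * D * C / (3 * K * e) < (l : ℝ) := hl₀.trans_le (by exact_mod_cast hl)
  have hlpos : (0 : ℝ) < l := lt_of_le_of_lt (by positivity) hll
  rw [div_lt_iff₀ (by positivity)] at hll
  have ha : 0 < a := by linarith
  have hA : 0 ≤ (1 + x) ^ l * a := by positivity
  have hB : 0 ≤ (1 - x) ^ l * b := mul_nonneg (pow_nonneg (by linarith) _) hb
  by_cases hcase : 2 * K ≤ l * x * c
  · have hbern : 1 + (l : ℝ) * x ≤ (1 + x) ^ l := one_add_mul_le_pow (by linarith) l
    have : (1 + (l : ℝ) * x) * c ≤ (1 + x) ^ l * a :=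
      mul_le_mul hbern (by linarith) hc.le (by positivity)
    nlinarith
  · push Not at hcase
    have hlx : l * x ≤ C := by
      rw [hC, le_div_iff₀ hc]; exact hcase.le
    set P := (1 - x ^ 2) ^ l with hP
    have hx2 : x ^ 2 ≤ 1 := by nlinarith
    have hP0 : 0 ≤ P := pow_nonneg (by linarith) _
    have hP1 : P ≤ 1 := pow_le_one₀ (by linarith) (by nlinarith)
    have hPb : 1 - C * x ≤ P := by
      have := one_add_mul_le_pow (a := -x ^ 2) (by linarith) l
      rw [← sub_eq_add_neg 1 (x ^ 2)] at this
      nlinarith [mul_le_mul_of_nonneg_right hlx hx0]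
    have hAB : ((1 + x) ^ l * a) * ((1 - x) ^ l * b) = P * (a * b) := by
      rw [hP, show 1 - x ^ 2 = (1 + x) * (1 - x) by ring, mul_pow]; ring
    have hτx : 0 ≤ τ * x := mul_nonneg hτ hx0
    have hQ : K ^ 2 - τ * x ≤ a * b := by
      have h1 : a0 * b ≤ a * b := mul_le_mul_of_nonneg_right haa hb
      have h2 : a0 * (b0 - τ * x) ≤ a0 * b := mul_le_mul_of_nonneg_left hbb (by linarith)
      have h3 : a0 * (τ * x) ≤ 1 * (τ * x) := mul_le_mul_of_nonneg_right ha1 hτx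
      linarith
    have hPQ : K ^ 2 - D * x ≤ P * (a * b) := by
      have h1 := mul_le_mul_of_nonneg_left hQ hP0
      have h2 : P * (τ * x) ≤ 1 * (τ * x) := mul_le_mul_of_nonneg_right hP1 hτx
      have h3 := mul_le_mul_of_nonneg_right hPb (sq_nonneg K)
      have h4 : K ^ 2 - D * x = (1 - C * x) * K ^ 2 - 1 * (τ * x) := by rw [hD]; ring
      have h5 : P * (K ^ 2 - τ * x) = P * K ^ 2 - P * (τ * x) := by ring
      linarith
    have hDx : 4 * (D * x) < 3 * K * e := by
      have : l * (4 * (D * x)) < l * (3 * K * e) := by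
        have := mul_le_mul_of_nonneg_left hlx (by positivity : 0 ≤ 4 * D)
        have r1 : 4 * D * (l * x) = l * (4 * (D * x)) := by ring
        linarith
      exact lt_of_mul_lt_mul_left this hlpos.le
    set A := (1 + x) ^ l * a
    set B := (1 - x) ^ l * b
    have hsq : (2 * K - e) ^ 2 < (A + B) ^ 2 := by
      have q1 : (2 * K - e) ^ 2 = 4 * K ^ 2 - 4 * (K * e) + e * e := by ring
      have q2 : (A + B) ^ 2 = (A - B) ^ 2 + 4 * (A * B) := by ring
      have q3 : e * e ≤ K * e := mul_le_mul_of_nonneg_right heK he0.le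
      have q4 := sq_nonneg (A - B)
      have q5 : 4 * (D * x) < 3 * (K * e) := by linarith
      rw [q1, q2, hAB]
      linarith
    have := lt_of_pow_lt_pow_left₀ 2 (by positivity) hsq
    linarith

open Filter Topology in
lemma backward_half (p : ℕ) [NeZero p] {m t : ℕ} (M : Matrix (Fin m) (Fin t) (ZMod p))
    (hW : IsWeaklyAlon p M) (n : ℕ) (hn : n ≥ 1) (f : G p n → ℝ) (hf : ∀ x, 0 ≤ f x ∧ f x ≤ 1)
    (hE : expect p n f = 1 / 2) (hb : 0 < TM p M n (fun x => 1 - f x))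
    (hab : TM p M n (fun x => 1 - f x) ≤ TM p M n f) :
    TM p M n f * TM p M n (fun x => 1 - f x) ≥ ((1 / 2 : ℝ) ^ t) ^ 2 := by
  set a := TM p M n f with ha_def
  set b := TM p M n (fun x => 1 - f x) with hb_def
  have ha : 0 < a := hb.trans_le hab
  set K := (1 / 2 : ℝ) ^ t with hK
  have hK0 : 0 < K := by positivity
  by_contra hlt
  push Not at hlt
  set r := Real.sqrt (a * b) with hr
  have hr2 : r ^ 2 = a * b := Real.sq_sqrt (by positivity)
  have hr0 : 0 < r := Real.sqrt_pos.2 (by positivity)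
  have hrK : r < K := by
    rw [← hr2] at hlt
    exact lt_of_pow_lt_pow_left₀ 2 hK0.le hlt
  obtain ⟨l₀, hl₀⟩ := hW (K - r) (by linarith)
  have hbr : b ≤ r := by
    refine le_of_sq_le_sq ?_ hr0.le
    nlinarith
  set s := Real.log (r / b) with hs
  have hs0 : 0 ≤ s := Real.log_nonneg (by rwa [one_le_div hb])
  have hexp : Real.exp s = r / b := Real.exp_log (by positivity)
  have hexpn : Real.exp (-s) = b / r := by rw [Real.exp_neg, hexp, inv_div]
  set φ : ℝ → ℝ := fun y => TM p M n (fun x => 1 - (1 - y) * f x) with hφ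
  have hφc : Continuous φ := by
    simp only [hφ, TM]
    fun_prop
  have hφ0 : φ 0 = b := by simp [hφ, hb_def]
  have hy : Tendsto (fun l : ℕ => s / (l : ℝ)) atTop (𝓝 0) := tendsto_const_div_atTop_nhds_zero_nat s
  have h1 : Tendsto (fun l : ℕ => φ (s / l)) atTop (𝓝 b) := by
    have := (hφc.tendsto 0).comp hy
    rwa [hφ0] at this
  have h2 : Tendsto (fun l : ℕ => (1 + s / (l : ℝ)) ^ l) atTop (𝓝 (Real.exp s)) :=
    Real.tendsto_one_add_div_pow_exp s
  have h3 : Tendsto (fun l : ℕ => (1 - s / (l : ℝ)) ^ l) atTop (𝓝 (Real.exp (-s))) := by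
    have := Real.tendsto_one_add_div_pow_exp (-s)
    refine this.congr fun l => ?_
    rw [neg_div, sub_eq_add_neg]
  have h4 : Tendsto (fun l : ℕ => (1 - s / (l : ℝ)) ^ l * ((1 - s / (l : ℝ)) ^ t * a)
      + (1 + s / (l : ℝ)) ^ l * φ (s / l)) atTop
      (𝓝 (Real.exp (-s) * ((1 - 0) ^ t * a) + Real.exp s * b)) :=
    (h3.mul (((tendsto_const_nhds.sub hy).pow t).mul_const a)).add (h2.mul h1)
  have hlim : Real.exp (-s) * ((1 - 0) ^ t * a) + Real.exp s * b = 2 * r := by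
    rw [hexp, hexpn]
    simp only [sub_zero, one_pow, one_mul]
    field_simp
    nlinarith
  rw [hlim] at h4
  have h5 : K + r ≤ 2 * r := by
    refine ge_of_tendsto h4 ?_
    have hev : ∀ᶠ l : ℕ in atTop, s / (l : ℝ) < 1 := hy.eventually (gt_mem_nhds one_pos)
    filter_upwards [hev, eventually_ge_atTop l₀] with l hl1 hll
    have hy0 : 0 ≤ s / (l : ℝ) := div_nonneg hs0 (Nat.cast_nonneg _)
    set y := s / (l : ℝ)
    have hW' := hl₀ l hll n hn (fun x => (1 - y) * f x) (fun x => ⟨mul_nonneg (by linarith) (hf x).1,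
      mul_le_one₀ (by linarith) (hf x).1 (hf x).2⟩)
    rw [TM_smul, expect_smul, hE, ← ha_def,
      show TM p M n (fun x => 1 - (1 - y) * f x) = φ y from rfl,
      show (1 - y) * (1 / 2 : ℝ) = (1 / 2) * (1 - y) by ring,
      show 1 - (1 / 2 : ℝ) * (1 - y) = (1 / 2) * (1 + y) by ring, mul_pow, mul_pow] at hW'
    have e1 : (2 : ℝ) ^ (-(l : ℤ)) = (1 / 2) ^ l := by
      rw [zpow_neg, zpow_natCast, one_div, inv_pow]
    have e2 : (2 : ℝ) ^ (1 - (t : ℤ)) = 2 * K := by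
      rw [zpow_sub₀ two_ne_zero, zpow_one, zpow_natCast, hK, one_div, inv_pow]; rfl
    rw [e1, e2] at hW'
    have hpos : (0 : ℝ) < (1 / 2) ^ l := by positivity
    have : (1 / 2 : ℝ) ^ l * (2 * K - (K - r)) < (1 / 2) ^ l * ((1 - y) ^ l * ((1 - y) ^ t * a)
      + (1 + y) ^ l * φ y) := by linarith
    have := lt_of_mul_lt_mul_left this hpos.le
    linarith
  linarith

theorem geometricallyCommon_iff_weaklyAlon (p : ℕ) [NeZero p] (hp : p.Prime)
    {m t : ℕ} (hmt : m < t) (M : Matrix (Fin m) (Fin t) (ZMod p)) (hrank : M.rank = m)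
    (hker : ∀ i : Fin t, ∃ v : Fin t → ZMod p, M.mulVec v = 0 ∧ v i ≠ 0)
    (hprev : IsHalfPrevalent p M) :
    IsGeometricallyCommon p M ↔ IsWeaklyAlon p M := by
  obtain ⟨c, hc, hprev⟩ := hprev
  have e3 : (2 : ℝ) ^ (-(2 * (t : ℤ))) = ((1 / 2 : ℝ) ^ t) ^ 2 := by
    rw [zpow_neg, one_div, inv_pow, inv_pow, ← pow_mul, mul_comm t 2, ← zpow_natCast]
    push_cast
    rfl
  have e2 : (2 : ℝ) ^ (1 - (t : ℤ)) = 2 * (1 / 2 : ℝ) ^ t := by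
    rw [zpow_sub₀ two_ne_zero, zpow_one, zpow_natCast, one_div, inv_pow]; rfl
  constructor
  · intro hG ε hε
    obtain ⟨l₀, hl₀⟩ := core_real c ((1 / 2 : ℝ) ^ t) ε (t / 2) hc (by positivity) hε (by positivity)
    refine ⟨l₀, ?_⟩
    intro l hl n hn
    have e1 : (2 : ℝ) ^ (-(l : ℤ)) = (1 / 2) ^ l := by
      rw [zpow_neg, zpow_natCast, one_div, inv_pow]
    have main : ∀ f : G p n → ℝ, (∀ x, 0 ≤ f x ∧ f x ≤ 1) → 1 / 2 ≤ expect p n f →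
        (expect p n f) ^ l * TM p M n f + (1 - expect p n f) ^ l * TM p M n (fun x => 1 - f x) >
          (2 : ℝ) ^ (-(l : ℤ)) * ((2 : ℝ) ^ (1 - (t : ℤ)) - ε) := by
      intro f hf hα
      set α := expect p n f with hαdef
      have hα1 : α ≤ 1 := by
        have := expect_nonneg' p n (fun x => 1 - f x) (fun x => by linarith [(hf x).2])
        rw [expect_one_sub] at this
        linarith
      have hq0 : 0 < 1 / (2 * α) := by positivity
      have hq1 : 1 / (2 * α) ≤ 1 := by rw [div_le_one (by linarith)]; linarith
      set q := 1 / (2 * α) with hq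
      set g : G p n → ℝ := fun x => q * f x with hg
      have hg01 : ∀ x, 0 ≤ g x ∧ g x ≤ 1 := fun x =>
        ⟨mul_nonneg hq0.le (hf x).1, mul_le_one₀ hq1 (hf x).1 (hf x).2⟩
      have hgf : ∀ x, g x ≤ f x := fun x => mul_le_of_le_one_left (hf x).1 hq1
      have hgE : expect p n g = 1 / 2 := by
        rw [hg, expect_smul, ← hαdef, hq]; field_simp
      have hgT : TM p M n g ≤ TM p M n f := by
        rw [hg, TM_smul]
        exact mul_le_of_le_one_left (TM_nonneg p M n f fun x => (hf x).1) (pow_le_one₀ hq0.le hq1)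
      have hsub := TM_sub_le p M n hp hker (fun x => 1 - f x) (fun x => 1 - g x)
        (fun x => by linarith [(hf x).2]) (fun x => by linarith [hgf x])
        (fun x => by linarith [(hg01 x).1])
      rw [expect_one_sub, expect_one_sub, hgE, ← hαdef] at hsub
      have hGg := hG n hn g hg01 hgE
      rw [e3] at hGg
      have := hl₀ l hl (2 * α - 1) (TM p M n f) (TM p M n (fun x => 1 - f x)) (TM p M n g)
        (TM p M n (fun x => 1 - g x)) (by linarith) (by linarith) (hprev n hn g hg01 hgE)
        (TM_le_one p M n g hg01) hgT (TM_nonneg p M n _ fun x => by linarith [(hf x).2])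
        (by linarith) hGg
      rw [e1, e2]
      have hpos : (0 : ℝ) < (1 / 2) ^ l := by positivity
      have h2 := mul_lt_mul_of_pos_left this hpos
      refine lt_of_lt_of_eq h2 ?_
      rw [mul_add, ← mul_assoc, ← mul_assoc, ← mul_pow, ← mul_pow]
      congr 3 <;> ring
    intro f hf
    rcases le_total (1 / 2) (expect p n f) with h | h
    · exact main f hf h
    · have := main (fun x => 1 - f x) (fun x => ⟨by linarith [(hf x).2], by linarith [(hf x).1]⟩)
        (by rw [expect_one_sub]; linarith)
      rw [expect_one_sub] at this
      simp only [sub_sub_cancel] at this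
      linarith
  · intro hW n hn f hf hE
    rw [e3]
    have hf' : ∀ x, 0 ≤ 1 - f x ∧ 1 - f x ≤ 1 :=
      fun x => ⟨by linarith [(hf x).2], by linarith [(hf x).1]⟩
    have hE' : expect p n (fun x => 1 - f x) = 1 / 2 := by rw [expect_one_sub, hE]; norm_num
    have ha := hprev n hn f hf hE
    have hb := hprev n hn _ hf' hE'
    rcases le_total (TM p M n (fun x => 1 - f x)) (TM p M n f) with h | h
    · exact backward_half p M hW n hn f hf hE (by linarith) h
    · have := backward_half p M hW n hn (fun x => 1 - f x) hf' hE'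
        (by simp only [sub_sub_cancel]; linarith) (by simpa only [sub_sub_cancel] using h)
      simp only [sub_sub_cancel] at this
      rwa [mul_comm] at this
end
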